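/- Let H be a real Hilbert space with norm ‖·‖ and seminorm |·|, V ⊂ H a finite-dimensional subspace satisfying an inverse inequality |v| ≤ (γ/h)‖v‖ for all v ∈ V with constants γ, h > 0, and let Π : H → V satisfy |Πu| ≤ |u| and ‖u − Πu‖ ≤ (h/π)|u| for all u ∈ H. Let Q : W → V be the ‖·‖-orthogonal projection from a subspace W ⊇ V. Then for all w ∈ W: |Qw| ≤ |Πw| + (γ/h)(‖w − Πw‖ + ‖w − Qw‖) ≤ (1 + 2γ/π)|w|. -/

import Mathlib

open Real

/-- Abstract stability of the `‖·‖`-orthogonal projection `Q` onto `V` in the seminorm `|·|`: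
combining a seminorm-stable projector `P` with approximation order `h/π`, an inverse
inequality `|v| ≤ (γ/h)‖v‖` on `V`, and the best-approximation property of `Q` yields
`|Qw| ≤ |Pw| + (γ/h)(‖w − Pw‖ + ‖w − Qw‖) ≤ (1 + 2γ/π)|w|`. -/
theorem stmt15 {H : Type*} [NormedAddCommGroup H] [NormedSpace ℝ H]
    (s : Seminorm ℝ H) (V W : Submodule ℝ H) (hVW : V ≤ W)
    (γ h : ℝ) (hγ : 0 < γ) (hh : 0 < h)
    (hinv : ∀ v ∈ V, s v ≤ (γ / h) * ‖v‖)
    (P : H → H) (hPmem : ∀ u : H, P u ∈ V)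
    (hPstab : ∀ u : H, s (P u) ≤ s u)
    (hPapprox : ∀ u : H, ‖u - P u‖ ≤ (h / Real.pi) * s u)
    (w : H) (hw : w ∈ W) (Qw : H) (hQ : Qw ∈ V)
    (hmin : ∀ v ∈ V, ‖w - Qw‖ ≤ ‖w - v‖) :
    s Qw ≤ s (P w) + (γ / h) * (‖w - P w‖ + ‖w - Qw‖) ∧
      s (P w) + (γ / h) * (‖w - P w‖ + ‖w - Qw‖) ≤ (1 + 2 * γ / Real.pi) * s w := by
  have hpos : 0 < γ / h := div_pos hγ hh
  have hpi := Real.pi_pos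
  constructor
  · have h1 : s Qw ≤ s (P w) + s (Qw - P w) := by
      have := map_add_le_add s (P w) (Qw - P w)
      rwa [add_sub_cancel] at this
    have h2 := hinv _ (V.sub_mem hQ (hPmem w))
    have h3 : ‖Qw - P w‖ ≤ ‖w - P w‖ + ‖w - Qw‖ := by
      have := norm_sub_le (w - P w) (w - Qw)
      rwa [sub_sub_sub_cancel_left] at this
    have h4 := mul_le_mul_of_nonneg_left h3 hpos.le
    linarith
  · have h1 := hPapprox w
    have h2 := hmin _ (hPmem w)
    have h3 : ‖w - P w‖ + ‖w - Qw‖ ≤ 2 * ((h / Real.pi) * s w) := by linarith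
    have h4 := mul_le_mul_of_nonneg_left h3 hpos.le
    have h5 : (γ / h) * (2 * ((h / Real.pi) * s w)) = 2 * γ / Real.pi * s w := by
      field_simp
    have h6 := hPstab w
    linarith
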